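/- Let α and β be non-increasing weight sequences, X, U, Y complex Hilbert spaces, T ∈ L(X), E ∈ L(X,Y), N ∈ L(X,U), with (E,T) β-output stable and (N,T) α-output stable. Suppose S : 𝔻 → L(U,Y) is a contractive multiplier from H²_α(U) to H²_β(Y), with Taylor coefficients (S_j), such that for every sequence (h_k)_{k≥0} in U with Σ_k α_k ‖h_k‖² < ∞ and every x ∈ X, the series Σ_{ℓ≥0} ⟨Σ_{j=0}^{ℓ} S_j h_{ℓ−j}, E T^ℓ x⟩_Y and Σ_{k≥0} ⟨h_k, N T^k x⟩_U both converge and are equal. Then for every x ∈ X: Σ_{j≥0} β_j^{-1} ‖E T^j x‖² ≥ Σ_{j≥0} α_j^{-1} ‖N T^j x‖². -/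

import Mathlib

open Metric Filter

noncomputable section

/-- `β` is a weight sequence: positive, `β 0 = 1`, and `liminf β_j^(1/j) ≥ 1`. -/
def IsWeightSeq (β : ℕ → ℝ) : Prop :=
  (∀ j, 0 < β j) ∧ β 0 = 1 ∧
    1 ≤ Filter.liminf (fun j : ℕ => β j ^ ((1 : ℝ) / j)) Filter.atTop

/-- The pair `(E,T)` is `β`-output stable. -/
def OutputStable {X Y : Type*} [NormedAddCommGroup X] [InnerProductSpace ℂ X]
    [NormedAddCommGroup Y] [InnerProductSpace ℂ Y]
    (β : ℕ → ℝ) (E : X →L[ℂ] Y) (T : X →L[ℂ] X) : Prop :=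
  ∃ C : ℝ, 0 ≤ C ∧ ∀ x : X,
    Summable (fun j => (β j)⁻¹ * ‖E ((T ^ j) x)‖ ^ 2) ∧
    ∑' j, (β j)⁻¹ * ‖E ((T ^ j) x)‖ ^ 2 ≤ C * ‖x‖ ^ 2

/-- `S`, with Taylor coefficients `Sc`, is a contractive multiplier from `H²_α(U)` to
`H²_β(Y)`. -/
def IsContractiveMultiplierW {U Y : Type*} [NormedAddCommGroup U] [InnerProductSpace ℂ U]
    [NormedAddCommGroup Y] [InnerProductSpace ℂ Y]
    (α β : ℕ → ℝ) (Sc : ℕ → (U →L[ℂ] Y)) : Prop :=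
  ∀ h : ℕ → U, Summable (fun k => α k * ‖h k‖ ^ 2) →
    Summable (fun ℓ => β ℓ * ‖∑ j ∈ Finset.range (ℓ + 1), Sc j (h (ℓ - j))‖ ^ 2) ∧
    ∑' ℓ, β ℓ * ‖∑ j ∈ Finset.range (ℓ + 1), Sc j (h (ℓ - j))‖ ^ 2
      ≤ ∑' k, α k * ‖h k‖ ^ 2

/-- Weighted Young inequality for the real part of an inner product. -/
theorem re_inner_le_weighted {Y : Type*} [NormedAddCommGroup Y] [InnerProductSpace ℂ Y]
    {b : ℝ} (hb : 0 < b) (u v : Y) :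
    (inner ℂ u v).re ≤ (b⁻¹ * ‖u‖ ^ 2 + b * ‖v‖ ^ 2) / 2 := by
  have h₁ : (inner ℂ u v).re ≤ ‖u‖ * ‖v‖ := re_inner_le_norm (𝕜 := ℂ) u v
  have h₂ : b⁻¹ * ‖u‖ ^ 2 + b * ‖v‖ ^ 2 - 2 * (‖u‖ * ‖v‖) = b⁻¹ * (‖u‖ - b * ‖v‖) ^ 2 := by
    field_simp
    ring
  have h₃ : 0 ≤ b⁻¹ * (‖u‖ - b * ‖v‖) ^ 2 := by positivity
  linarith

theorem stmt12 {X U Y : Type*}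
    [NormedAddCommGroup X] [InnerProductSpace ℂ X] [CompleteSpace X]
    [NormedAddCommGroup U] [InnerProductSpace ℂ U] [CompleteSpace U]
    [NormedAddCommGroup Y] [InnerProductSpace ℂ Y] [CompleteSpace Y]
    (α : ℕ → ℝ) (hα : IsWeightSeq α) (hαmono : ∀ j, α (j + 1) ≤ α j)
    (β : ℕ → ℝ) (hβ : IsWeightSeq β) (hβmono : ∀ j, β (j + 1) ≤ β j)
    (T : X →L[ℂ] X) (E : X →L[ℂ] Y) (N : X →L[ℂ] U)
    (hET : OutputStable β E T) (hNT : OutputStable α N T)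
    (S : ℂ → (U →L[ℂ] Y)) (Sc : ℕ → (U →L[ℂ] Y))
    (hTaylor : ∀ z ∈ ball (0 : ℂ) 1, HasSum (fun j => z ^ j • Sc j) (S z))
    (hmult : IsContractiveMultiplierW α β Sc)
    -- the interpolation condition in the form `O*_{β,E,T} M_S = O*_{α,N,T}`
    (hint : ∀ h : ℕ → U, Summable (fun k => α k * ‖h k‖ ^ 2) → ∀ x : X, ∃ s : ℂ,
      HasSum (fun ℓ => inner (𝕜 := ℂ) (E ((T ^ ℓ) x))
        (∑ j ∈ Finset.range (ℓ + 1), Sc j (h (ℓ - j)))) s ∧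
      HasSum (fun k => inner (𝕜 := ℂ) (N ((T ^ k) x)) (h k)) s) :
    ∀ x : X, ∑' j, (α j)⁻¹ * ‖N ((T ^ j) x)‖ ^ 2
      ≤ ∑' j, (β j)⁻¹ * ‖E ((T ^ j) x)‖ ^ 2 := by
  intro x
  obtain ⟨_, _, hE⟩ := hET
  obtain ⟨_, _, hN⟩ := hNT
  set h : ℕ → U := fun k => (((α k)⁻¹ : ℝ) : ℂ) • N ((T ^ k) x) with hh
  have hα_norm : ∀ k, α k * ‖h k‖ ^ 2 = (α k)⁻¹ * ‖N ((T ^ k) x)‖ ^ 2 := by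
    intro k
    have hk := hα.1 k
    simp only [hh, norm_smul, Complex.norm_real, Real.norm_eq_abs, mul_pow, sq_abs]
    field_simp
  have h_inner : ∀ k, (inner ℂ (N ((T ^ k) x)) (h k)).re = (α k)⁻¹ * ‖N ((T ^ k) x)‖ ^ 2 := by
    intro k
    rw [hh, inner_smul_right, inner_self_eq_norm_sq_to_K, Complex.re_ofReal_mul]
    norm_cast
  have h_summable : Summable (fun k => α k * ‖h k‖ ^ 2) := by
    simpa only [hα_norm] using (hN x).1
  obtain ⟨hg, hg_le⟩ := hmult h h_summable
  obtain ⟨s, hsE, hsN⟩ := hint h h_summable x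
  have hN_sum : ∑' k, (α k)⁻¹ * ‖N ((T ^ k) x)‖ ^ 2 = s.re := by
    have := Complex.hasSum_re hsN
    simp only [h_inner] at this
    exact this.tsum_eq
  have h_young := hasSum_le (fun ℓ => re_inner_le_weighted (hβ.1 ℓ) _ _)
    (Complex.hasSum_re hsE) (((hE x).1.hasSum.add hg.hasSum).div_const 2)
  simp only [hα_norm] at hg_le
  linarith
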